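/- Let τ₀, τ₁ > 0 and let t₀ < t₁ < t₂ be real numbers with t₁ = t₀ + τ₀ and t₂ = t₁ + τ₁. Let f : ℝ → ℝ be three times continuously differentiable on [t₀, t₂] with |f'''(t)| ≤ M for all t ∈ [t₀, t₂]. Then |D[f(t₂), f(t₁), f(t₀)] / τ₁ − f'(t₂)| ≤ M · τ₁(τ₁ + τ₀)(2τ₁ + τ₀) / (6τ₀). In particular, if the step ratio τ₁/τ₀ is bounded, the variable-step BDF2 approximation of the first derivative is of second order in the step size. -/

import Mathlib

/-- Variable-step BDF2 difference operator:
`D[f₂, f₁, f₀] = ((2τ₁+τ₀)/(τ₁+τ₀))·f₂ − ((τ₁+τ₀)/τ₀)·f₁ + (τ₁²/(τ₀(τ₁+τ₀)))·f₀`. -/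
noncomputable def bdf2D (τ₀ τ₁ f₂ f₁ f₀ : ℝ) : ℝ :=
  ((2 * τ₁ + τ₀) / (τ₁ + τ₀)) * f₂ - ((τ₁ + τ₀) / τ₀) * f₁ +
    (τ₁ ^ 2 / (τ₀ * (τ₁ + τ₀))) * f₀

open Set Filter Topology Nat in
/-- Taylor's theorem at the right endpoint of an interval, with a bound on the remainder. -/
theorem abs_sub_taylorWithinEval_right_le {f : ℝ → ℝ} {a b x C : ℝ} {n : ℕ} (hax : a ≤ x)
    (hxb : x < b) (hf : ContDiffOn ℝ (n + 1) f (Icc a b))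
    (hC : ∀ y ∈ Icc a b, |iteratedDerivWithin (n + 1) f (Icc a b) y| ≤ C) :
    |f x - taylorWithinEval f n (Icc a b) b x| ≤ C * (b - x) ^ (n + 1) / (n + 1)! := by
  have hsub : Icc x b ⊆ Icc a b := Icc_subset_Icc_left hax
  have hu : uIcc b x = Icc x b := uIcc_of_ge hxb.le
  have hcongr {y : ℝ} (hy : x < y) (k : ℕ) :
      iteratedDerivWithin k f (Icc x b) y = iteratedDerivWithin k f (Icc a b) y := by
    have hset : Icc x b =ᶠ[𝓝 y] Icc a b := by
      filter_upwards [Ioi_mem_nhds hy] with z hz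
      exact propext ⟨fun h => hsub h, fun h => ⟨le_of_lt hz, h.2⟩⟩
    simp only [iteratedDerivWithin, iteratedFDerivWithin_congr_set hset]
  have htaylor : taylorWithinEval f n (uIcc b x) b x = taylorWithinEval f n (Icc a b) b x := by
    simp only [taylor_within_apply, hu, hcongr hxb]
  have hfx : ContDiffOn ℝ (n + 1) f (uIcc b x) := hu ▸ hf.mono hsub
  have hd : DifferentiableOn ℝ (iteratedDerivWithin n f (uIcc b x)) (uIcc b x) :=
    hfx.differentiableOn_iteratedDerivWithin (mod_cast n.lt_succ_self) (uniqueDiffOn_uIcc hxb.ne')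
  obtain ⟨y, hy, h⟩ :=
    taylor_mean_remainder_lagrange hxb.ne' hfx.of_succ (hd.mono Ioo_subset_Icc_self)
  rw [uIoo_of_ge hxb.le] at hy
  rw [← htaylor, h, hu, hcongr hy.1, abs_div, abs_mul, abs_pow, abs_sub_comm,
    abs_of_pos (sub_pos.2 hxb), Nat.abs_cast]
  have := hC y ⟨hax.trans hy.1.le, hy.2.le⟩
  have := sub_pos.2 hxb
  gcongr

/-- Second-order error bound for the variable-step BDF2 approximation of the first
derivative: if `f` is three times continuously differentiable on `[t₀, t₂]` with
`|f'''| ≤ M` there, then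
`|D[f(t₂), f(t₁), f(t₀)]/τ₁ − f'(t₂)| ≤ M·τ₁(τ₁+τ₀)(2τ₁+τ₀)/(6τ₀)`. -/
theorem bdf2_second_order_error_bound (τ₀ τ₁ t₀ t₁ t₂ M : ℝ)
    (hτ₀ : 0 < τ₀) (hτ₁ : 0 < τ₁)
    (h01 : t₀ < t₁) (h12 : t₁ < t₂)
    (ht₁ : t₁ = t₀ + τ₀) (ht₂ : t₂ = t₁ + τ₁)
    (f : ℝ → ℝ)
    (hf : ContDiffOn ℝ 3 f (Set.Icc t₀ t₂))
    (hM : ∀ t ∈ Set.Icc t₀ t₂, |iteratedDerivWithin 3 f (Set.Icc t₀ t₂) t| ≤ M) :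
    |bdf2D τ₀ τ₁ (f t₂) (f t₁) (f t₀) / τ₁ - derivWithin f (Set.Icc t₀ t₂) t₂| ≤
      M * (τ₁ * (τ₁ + τ₀) * (2 * τ₁ + τ₀)) / (6 * τ₀) := by
  have expand (x : ℝ) : taylorWithinEval f 2 (Set.Icc t₀ t₂) t₂ x =
      f t₂ + derivWithin f (Set.Icc t₀ t₂) t₂ * (x - t₂) +
        iteratedDerivWithin 2 f (Set.Icc t₀ t₂) t₂ / 2 * (x - t₂) ^ 2 := by
    simp [taylorWithinEval_succ, iteratedDerivWithin_one]
    ring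
  have hf' : ContDiffOn ℝ ((2 : ℕ) + 1) f (Set.Icc t₀ t₂) := by
    convert hf using 1; norm_num
  have h₁ := abs_sub_taylorWithinEval_right_le h01.le h12 hf' hM
  have h₀ := abs_sub_taylorWithinEval_right_le le_rfl (h01.trans h12) hf' hM
  rw [expand] at h₁ h₀
  set d := derivWithin f (Set.Icc t₀ t₂) t₂
  set e := iteratedDerivWithin 2 f (Set.Icc t₀ t₂) t₂
  set R₁ := f t₁ - (f t₂ + d * (t₁ - t₂) + e / 2 * (t₁ - t₂) ^ 2) with hR₁
  set R₀ := f t₀ - (f t₂ + d * (t₀ - t₂) + e / 2 * (t₀ - t₂) ^ 2) with hR₀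
  have hs₁ : t₂ - t₁ = τ₁ := by linarith
  have hs₀ : t₂ - t₀ = τ₁ + τ₀ := by linarith
  rw [hs₁] at h₁
  rw [hs₀] at h₀
  have hsum : 0 < τ₁ + τ₀ := add_pos hτ₁ hτ₀
  have key : bdf2D τ₀ τ₁ (f t₂) (f t₁) (f t₀) / τ₁ - d =
      τ₁ / (τ₀ * (τ₁ + τ₀)) * R₀ - (τ₁ + τ₀) / (τ₀ * τ₁) * R₁ := by
    rw [hR₀, hR₁, ← neg_sub t₂ t₁, ← neg_sub t₂ t₀, hs₁, hs₀, bdf2D]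
    field_simp
    ring
  rw [key]
  calc |τ₁ / (τ₀ * (τ₁ + τ₀)) * R₀ - (τ₁ + τ₀) / (τ₀ * τ₁) * R₁|
      ≤ τ₁ / (τ₀ * (τ₁ + τ₀)) * |R₀| + (τ₁ + τ₀) / (τ₀ * τ₁) * |R₁| := by
        refine (abs_sub _ _).trans_eq ?_
        rw [abs_mul, abs_mul, abs_of_pos (by positivity : 0 < τ₁ / (τ₀ * (τ₁ + τ₀))),
          abs_of_pos (by positivity : 0 < (τ₁ + τ₀) / (τ₀ * τ₁))]
    _ ≤ τ₁ / (τ₀ * (τ₁ + τ₀)) * (M * (τ₁ + τ₀) ^ (2 + 1) / (2 + 1).factorial) +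
        (τ₁ + τ₀) / (τ₀ * τ₁) * (M * τ₁ ^ (2 + 1) / (2 + 1).factorial) := by gcongr
    _ = M * (τ₁ * (τ₁ + τ₀) * (2 * τ₁ + τ₀)) / (6 * τ₀) := by
        norm_num [Nat.factorial]
        field_simp
        ring
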